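/- Let Y ∈ ℝ^{P×T}, Ã ∈ ℝ^{P×K}, λ ≥ 0, α ∈ [0,1], and let 1 ∈ ℝ^T denote the all-ones vector. The zero matrix minimizes the sparse group lasso objective F(Z) = (1/2)‖Y − ÃZ‖_F² + λα Σ_{k=1}^K ‖z_{k,·}‖₁ + λ(1−α) Σ_{k=1}^K ‖z_{k,·}‖₂ over all entrywise-nonnegative Z ∈ ℝ^{K×T} if and only if λ(1−α) ≥ ‖((ÃᵀY)_{k,·} − λα·1)₊‖₂ for every k ∈ {1, …, K}. -/

import Mathlib

/-- The Euclidean (ℓ2) norm of a vector in ℝ^T. -/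
noncomputable def l2norm {n : ℕ} (v : Fin n → ℝ) : ℝ := Real.sqrt (∑ i, v i ^ 2)

/-- The ℓ1 norm of a vector in ℝ^T. -/
def l1norm {n : ℕ} (v : Fin n → ℝ) : ℝ := ∑ i, |v i|

/-- The sparse group lasso objective
  F(Z) = (1/2)‖Y − ÃZ‖_F² + λα Σ_k ‖z_k‖₁ + λ(1−α) Σ_k ‖z_k‖₂. -/
noncomputable def sglObj {P T K : ℕ} (Y : Fin P → Fin T → ℝ) (A : Fin P → Fin K → ℝ)
    (lam α : ℝ) (Z : Fin K → Fin T → ℝ) : ℝ :=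
  1 / 2 * (∑ p, ∑ t, (Y p t - ∑ k, A p k * Z k t) ^ 2)
    + lam * α * ∑ k, l1norm (Z k) + lam * (1 - α) * ∑ k, l2norm (Z k)

theorem sgl_diff {P T K : ℕ} (Y : Fin P → Fin T → ℝ) (A : Fin P → Fin K → ℝ)
    (lam α : ℝ) (Z : Fin K → Fin T → ℝ) (hZ : ∀ k t, 0 ≤ Z k t) :
    sglObj Y A lam α Z = sglObj Y A lam α 0
      + 1 / 2 * (∑ p, ∑ t, (∑ k, A p k * Z k t) ^ 2)
      + ∑ k, (lam * (1 - α) * l2norm (Z k)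
          - ∑ t, ((∑ p, A p k * Y p t) - lam * α) * Z k t) := by
  have h1 : ∑ p, ∑ t, (Y p t - ∑ k, A p k * Z k t) ^ 2
      = ∑ p, ∑ t, (Y p t) ^ 2 - 2 * ∑ p, ∑ t, Y p t * (∑ k, A p k * Z k t)
        + ∑ p, ∑ t, (∑ k, A p k * Z k t) ^ 2 := by
    simp only [Finset.mul_sum (a := (2:ℝ)), ← Finset.sum_sub_distrib, ← Finset.sum_add_distrib]
    refine Finset.sum_congr rfl fun p _ => Finset.sum_congr rfl fun t _ => ?_
    ring
  have h2 : ∑ p, ∑ t, Y p t * (∑ k, A p k * Z k t)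
      = ∑ k, ∑ t, (∑ p, A p k * Y p t) * Z k t := by
    simp only [Finset.mul_sum, Finset.sum_mul]
    calc _ = ∑ t, ∑ p, ∑ k, Y p t * (A p k * Z k t) := Finset.sum_comm
      _ = ∑ t, ∑ k, ∑ p, Y p t * (A p k * Z k t) :=
        Finset.sum_congr rfl fun t _ => Finset.sum_comm
      _ = ∑ k, ∑ t, ∑ p, Y p t * (A p k * Z k t) := Finset.sum_comm
      _ = _ := by
        refine Finset.sum_congr rfl fun k _ => Finset.sum_congr rfl fun t _ =>
          Finset.sum_congr rfl fun p _ => ?_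
        ring
  have h3 : ∀ k, l1norm (Z k) = ∑ t, Z k t := fun k =>
    Finset.sum_congr rfl fun t _ => abs_of_nonneg (hZ k t)
  have h0 : sglObj Y A lam α 0 = 1 / 2 * ∑ p, ∑ t, (Y p t) ^ 2 := by
    simp [sglObj, l1norm, l2norm]
  rw [h0]
  unfold sglObj
  rw [h1, h2]
  simp only [h3, sub_mul _ (lam * α), Finset.sum_sub_distrib, ← Finset.mul_sum]
  ring

theorem l2_sq {n : ℕ} (v : Fin n → ℝ) : l2norm v ^ 2 = ∑ i, v i ^ 2 :=
  Real.sq_sqrt (Finset.sum_nonneg fun i _ => sq_nonneg _)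

theorem stmt7 {P T K : ℕ} (Y : Fin P → Fin T → ℝ) (A : Fin P → Fin K → ℝ)
    (lam α : ℝ) (hlam : 0 ≤ lam) (hα0 : 0 ≤ α) (hα1 : α ≤ 1) :
    (∀ Z : Fin K → Fin T → ℝ, (∀ k t, 0 ≤ Z k t) →
        sglObj Y A lam α 0 ≤ sglObj Y A lam α Z)
      ↔
    ∀ k, l2norm (fun t => max ((∑ p, A p k * Y p t) - lam * α) 0) ≤ lam * (1 - α) := by
  constructor
  · intro h k
    set v : Fin T → ℝ := fun t => max ((∑ p, A p k * Y p t) - lam * α) 0 with hv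
    have hv0 : ∀ t, 0 ≤ v t := fun t => le_max_right _ _
    have hN : 0 ≤ l2norm v := Real.sqrt_nonneg _
    have hc : 0 ≤ lam * (1 - α) := mul_nonneg hlam (by linarith)
    have hvv : ∀ t, ((∑ p, A p k * Y p t) - lam * α) * v t = v t ^ 2 := by
      intro t
      simp only [hv]
      rcases le_total ((∑ p, A p k * Y p t) - lam * α) 0 with h' | h'
      · rw [max_eq_right h']; ring
      · rw [max_eq_left h']; ring
    obtain ⟨Q, hQ⟩ : ∃ Q, Q = ∑ p, ∑ t, (A p k * v t) ^ 2 := ⟨_, rfl⟩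
    have hQ0 : 0 ≤ Q := by rw [hQ]; positivity
    have key : ∀ s : ℝ, 0 < s →
        0 ≤ 1 / 2 * (s ^ 2 * Q) + (lam * (1 - α) * (s * l2norm v) - s * l2norm v ^ 2) := by
      intro s hs
      have hZ : ∀ j t, 0 ≤ (fun j t => if j = k then s * v t else 0 : Fin K → Fin T → ℝ) j t := by
        intro j t
        dsimp only
        split_ifs
        · exact mul_nonneg hs.le (hv0 t)
        · exact le_rfl
      have h1 := h _ hZ
      rw [sgl_diff Y A lam α _ hZ] at h1
      have e1 : ∑ p, ∑ t, (∑ j, A p j * (if j = k then s * v t else 0)) ^ 2 = s ^ 2 * Q := by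
        simp only [mul_ite, mul_zero, Finset.sum_ite_eq', Finset.mem_univ, if_true, hQ,
          Finset.mul_sum]
        refine Finset.sum_congr rfl fun p _ => Finset.sum_congr rfl fun t _ => ?_
        ring
      have e2 : ∑ j, (lam * (1 - α) * l2norm (fun t => if j = k then s * v t else 0)
          - ∑ t, ((∑ p, A p j * Y p t) - lam * α) * (if j = k then s * v t else 0))
          = lam * (1 - α) * (s * l2norm v) - s * l2norm v ^ 2 := by
        rw [Finset.sum_eq_single k]
        · simp only [if_true]
          congr 1
          · congr 1
            simp only [l2norm, mul_pow, ← Finset.mul_sum]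
            rw [Real.sqrt_mul (sq_nonneg s), Real.sqrt_sq hs.le]
          · rw [l2_sq, Finset.mul_sum]
            refine Finset.sum_congr rfl fun t _ => ?_
            rw [← hvv t]; ring
        · intro j _ hj
          simp [hj, l2norm]
        · simp
      rw [e1, e2] at h1
      linarith
    by_contra hlt
    push Not at hlt
    set N := l2norm v
    have hNpos : 0 < N := lt_of_le_of_lt hc hlt
    have hd : 0 < N * (N - lam * (1 - α)) := mul_pos hNpos (by linarith)
    obtain ⟨d, hdd⟩ : ∃ d, d = N * (N - lam * (1 - α)) := ⟨_, rfl⟩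
    rw [← hdd] at hd
    have hs : 0 < d / (Q + 1) := by positivity
    have h2 := key _ hs
    obtain ⟨s, hse⟩ : ∃ s, s = d / (Q + 1) := ⟨_, rfl⟩
    rw [← hse] at h2 hs
    have h3 : s * (Q + 1) = d := by rw [hse]; field_simp
    have h4 : 0 ≤ s * (1 / 2 * (s * Q) - d) := by rw [hdd]; linarith
    have h5 := nonneg_of_mul_nonneg_right h4 hs
    nlinarith
  · intro h Z hZ
    rw [sgl_diff Y A lam α Z hZ]
    have hq : 0 ≤ ∑ p, ∑ t, (∑ k, A p k * Z k t) ^ 2 := by positivity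
    have hk : 0 ≤ ∑ k, (lam * (1 - α) * l2norm (Z k)
          - ∑ t, ((∑ p, A p k * Y p t) - lam * α) * Z k t) := by
      refine Finset.sum_nonneg fun k _ => ?_
      have a1 : ∑ t, ((∑ p, A p k * Y p t) - lam * α) * Z k t
          ≤ ∑ t, max ((∑ p, A p k * Y p t) - lam * α) 0 * Z k t :=
        Finset.sum_le_sum fun t _ => mul_le_mul_of_nonneg_right (le_max_left _ _) (hZ k t)
      have a2 := Real.sum_mul_le_sqrt_mul_sqrt Finset.univ
        (fun t => max ((∑ p, A p k * Y p t) - lam * α) 0) (Z k)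
      have a3 := mul_le_mul_of_nonneg_right (h k) (Real.sqrt_nonneg (∑ t, Z k t ^ 2))
      unfold l2norm at *
      linarith
    linarith
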